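/- arXiv:2201.05656 — 2 statements merged into one kernel-verified Lean document; each statement's English description precedes it below -/
import Mathlib

section
/- Fix t > 1 and suppose (1 + p_ρ)/t < r < 1 for all admissible words ρ, where p_ρ = Σ_{τ∈S} (μ([ρτ])/μ([ρ]))·t^{|τ|}. If σ is an S-free admissible word with w(σ) < 1, then μ(G(σ,m))/μ([σ]) ≥ (1 − r)^m for all integers m ≥ 1. -/
open Filter MeasureTheory
open scoped BigOperators

namespace SFT

/-- A finite word `x_1 ⋯ x_m` is admissible if the `(x_{j+1}, x_j)` entry of `T`
equals `1` for all `1 ≤ j < m`. -/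
def Admissible {n : ℕ} (T : Matrix (Fin n) (Fin n) ℝ) (w : List (Fin n)) : Prop :=
  w.Chain' fun a b => T b a = 1

/-- The subshift of finite type `Σ` determined by `T`: bi-infinite sequences with
all transitions allowed. -/
def SFTspace {n : ℕ} (T : Matrix (Fin n) (Fin n) ℝ) : Set (ℤ → Fin n) :=
  {x | ∀ i : ℤ, T (x (i + 1)) (x i) = 1}

/-- The word `w` occurs in the bi-infinite sequence `x` starting at coordinate `a`. -/
def OccursAt {A : Type*} (w : List A) (x : ℤ → A) (a : ℤ) : Prop :=
  ∀ (j : ℕ) (h : j < w.length), x (a + j) = w.get ⟨j, h⟩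

/-- The word `w` occurs somewhere in the bi-infinite sequence `x`. -/
def Occurs {A : Type*} (w : List A) (x : ℤ → A) : Prop :=
  ∃ a : ℤ, OccursAt w x a

/-- `N_X(m)`: the number of words of length `m` occurring in elements of `X`. -/
noncomputable def wordCount {A : Type*} (X : Set (ℤ → A)) (m : ℕ) : ℕ :=
  {w : List A | w.length = m ∧ ∃ x ∈ X, Occurs w x}.ncard

/-- The entropy `h(X) = lim_{m→∞} (1/m) log N_X(m)` of a subshift (for subshifts the
limit exists, hence coincides with the limsup used here). -/
noncomputable def entropy {A : Type*} (X : Set (ℤ → A)) : ℝ :=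
  Filter.atTop.limsup fun m : ℕ => Real.log (wordCount X m) / m

/-- `Σ⟨S⟩`: the elements of `Σ` in which no word of `S` occurs. -/
def Avoid {n : ℕ} (T : Matrix (Fin n) (Fin n) ℝ) (S : Finset (List (Fin n))) :
    Set (ℤ → Fin n) :=
  {x ∈ SFTspace T | ∀ τ ∈ S, ¬ Occurs τ x}

/-- `p(t) = ∑_{τ ∈ S} t^{|τ|}`. -/
noncomputable def wordPoly {n : ℕ} (S : Finset (List (Fin n))) (t : ℝ) : ℝ :=
  ∑ τ ∈ S, t ^ τ.length

/-- The cylinder set `[σ]` (inside `Σ`), with `σ` beginning at coordinate `0`.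
It is empty when `σ` is not admissible. -/
def cylinder {n : ℕ} (T : Matrix (Fin n) (Fin n) ℝ) (σ : List (Fin n)) :
    Set (ℤ → Fin n) :=
  {x ∈ SFTspace T | OccursAt σ x 0}

/-- `N(σ, k)`: the number of words `η` of length `k` such that `ση` is admissible. -/
noncomputable def extCount {n : ℕ} (T : Matrix (Fin n) (Fin n) ℝ) (σ : List (Fin n))
    (k : ℕ) : ℕ :=
  {η : List (Fin n) | η.length = k ∧ Admissible T (σ ++ η)}.ncard

/-- A word is `S`-free if no element of `S` occurs in it as a consecutive subword. -/
def SFree {A : Type*} (S : Finset (List A)) (w : List A) : Prop :=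
  ∀ τ ∈ S, ¬ τ <:+: w

open Classical in
/-- `f_σ(α) = ∑_{τ ∈ S} ∑_j t^j`, the inner sum over integers `j ≥ 0` such that `τ`
occurs in `α` beginning within `σ` (placed at coordinate `0`) and ending `j` symbols
beyond the end of `σ`. -/
noncomputable def fword {n : ℕ} (S : Finset (List (Fin n))) (t : ℝ) (σ : List (Fin n))
    (x : ℤ → Fin n) : ℝ :=
  ∑ τ ∈ S, ∑ j ∈ Finset.range τ.length,
    if τ.length ≤ σ.length + j ∧ OccursAt τ x ((σ.length : ℤ) + j - τ.length)
    then t ^ j else 0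

/-- The weight `w(σ) = (1/μ([σ])) ∫_{[σ]} f_σ dμ`. -/
noncomputable def weight {n : ℕ} (T : Matrix (Fin n) (Fin n) ℝ)
    (μ : Measure (ℤ → Fin n)) (S : Finset (List (Fin n))) (t : ℝ)
    (σ : List (Fin n)) : ℝ :=
  (∫ x in cylinder T σ, fword S t σ x ∂μ) / (μ (cylinder T σ)).toReal

/-- `p_σ = ∑_{τ ∈ S} (μ([στ])/μ([σ])) t^{|τ|}`. -/
noncomputable def pWord {n : ℕ} (T : Matrix (Fin n) (Fin n) ℝ)
    (μ : Measure (ℤ → Fin n)) (S : Finset (List (Fin n))) (t : ℝ)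
    (σ : List (Fin n)) : ℝ :=
  ∑ τ ∈ S, (μ (cylinder T (σ ++ τ))).toReal / (μ (cylinder T σ)).toReal * t ^ τ.length

/-- `S_{σ,j}`: the subset of `[σ]` of elements containing some `τ ∈ S` that begins
within `σ` and ends `j` symbols after the end of `σ`. -/
def Ssub {n : ℕ} (T : Matrix (Fin n) (Fin n) ℝ) (S : Finset (List (Fin n)))
    (σ : List (Fin n)) (j : ℕ) : Set (ℤ → Fin n) :=
  {x ∈ cylinder T σ | ∃ τ ∈ S, τ.length ≤ σ.length + j ∧ j < τ.length ∧
    OccursAt τ x ((σ.length : ℤ) + j - τ.length)}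

/-- `η` is a good extension of an `S`-free word `σ`: `ση` is admissible and every
intermediate word between `σ` and `ση` (inclusive) has weight `< 1`. -/
def GoodExt {n : ℕ} (T : Matrix (Fin n) (Fin n) ℝ) (μ : Measure (ℤ → Fin n))
    (S : Finset (List (Fin n))) (t : ℝ) (σ η : List (Fin n)) : Prop :=
  Admissible T (σ ++ η) ∧ ∀ η', η' <+: η → weight T μ S t (σ ++ η') < 1

/-- `G(σ, m)`: union of the cylinder sets `[ση]` over good `η` of length `m`. -/
def GSet {n : ℕ} (T : Matrix (Fin n) (Fin n) ℝ) (μ : Measure (ℤ → Fin n))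
    (S : Finset (List (Fin n))) (t : ℝ) (σ : List (Fin n)) (m : ℕ) :
    Set (ℤ → Fin n) :=
  ⋃ η ∈ {η : List (Fin n) | η.length = m ∧ GoodExt T μ S t σ η}, cylinder T (σ ++ η)

/-- The alphabet of `Σ_k`: admissible words of length `k` in `Σ`. -/
def BlockAlphabet {n : ℕ} (T : Matrix (Fin n) (Fin n) ℝ) (k : ℕ) :=
  {w : List (Fin n) // w.length = k ∧ Admissible T w}

/-- `Σ_k`: the SFT on admissible `k`-blocks, where `[x_1⋯x_k][y_1⋯y_k]` is an
allowed transition iff `x_k y_1` is admissible in `Σ`. -/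
def SigmaBlock {n : ℕ} [NeZero n] (T : Matrix (Fin n) (Fin n) ℝ) (k : ℕ) :
    Set (ℤ → BlockAlphabet T k) :=
  {y | ∀ i : ℤ, T ((y (i + 1)).val.head!) ((y i).val.getLast!) = 1}

/-- The natural block-concatenation map `Σ_k → Σ`. -/
def blockConcat {n : ℕ} [NeZero n] (T : Matrix (Fin n) (Fin n) ℝ) (k : ℕ)
    (y : ℤ → BlockAlphabet T k) : ℤ → Fin n :=
  fun m => (y (Int.fdiv m k)).val.getD (Int.fmod m k).toNat default


section

variable {n : ℕ}

theorem measurableSet_SFTspace (T : Matrix (Fin n) (Fin n) ℝ) : MeasurableSet (SFTspace T) := by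
  have h : SFTspace T = ⋂ i : ℤ, (fun x : ℤ → Fin n => (x (i + 1), x i)) ⁻¹'
      {p : Fin n × Fin n | T p.1 p.2 = 1} := by
    ext x
    simp [SFTspace]
  rw [h]
  exact MeasurableSet.iInter fun i =>
    ((measurable_pi_apply (i + 1)).prodMk (measurable_pi_apply i)) (Set.toFinite _).measurableSet

theorem measurableSet_occursAt (w : List (Fin n)) (a : ℤ) :
    MeasurableSet {x : ℤ → Fin n | OccursAt w x a} := by
  have h : {x : ℤ → Fin n | OccursAt w x a} = ⋂ (j : ℕ) (hj : j < w.length),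
      (fun x : ℤ → Fin n => x (a + j)) ⁻¹' {w.get ⟨j, hj⟩} := by
    ext x
    simp [OccursAt]
  rw [h]
  exact MeasurableSet.iInter fun j => MeasurableSet.iInter fun _ =>
    (measurable_pi_apply _) (MeasurableSet.singleton _)

theorem measurableSet_cylinder (T : Matrix (Fin n) (Fin n) ℝ) (σ : List (Fin n)) :
    MeasurableSet (cylinder T σ) :=
  (measurableSet_SFTspace T).inter (measurableSet_occursAt σ 0)

theorem measurableSet_GSet (T : Matrix (Fin n) (Fin n) ℝ) (μ : Measure (ℤ → Fin n))
    (S : Finset (List (Fin n))) (t : ℝ) (σ : List (Fin n)) (m : ℕ) :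
    MeasurableSet (GSet T μ S t σ m) :=
  MeasurableSet.biUnion (Set.to_countable _) fun _ _ => measurableSet_cylinder T _

theorem occursAt_append {A : Type*} (σ τ : List A) (x : ℤ → A) (a : ℤ) :
    OccursAt (σ ++ τ) x a ↔ OccursAt σ x a ∧ OccursAt τ x (a + σ.length) := by
  constructor
  · refine fun h => ⟨fun j hj => ?_, fun j hj => ?_⟩
    · have := h j (by simp; omega)
      simpa [List.getElem_append_left hj] using this
    · have := h (σ.length + j) (by simp; omega)
      simpa [add_assoc] using this
  · rintro ⟨h₁, h₂⟩ j hj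
    by_cases hjσ : j < σ.length
    · simpa [List.getElem_append_left hjσ] using h₁ j hjσ
    · obtain ⟨k, rfl⟩ := Nat.exists_eq_add_of_le (not_lt.mp hjσ)
      have hk : k < τ.length := by simp at hj; omega
      simpa [add_assoc] using h₂ k hk

theorem cylinder_append (T : Matrix (Fin n) (Fin n) ℝ) (σ τ : List (Fin n)) :
    cylinder T (σ ++ τ) = cylinder T σ ∩ {x | OccursAt τ x σ.length} := by
  ext x
  simp only [cylinder, occursAt_append, zero_add, Set.mem_ofPred_eq, Set.mem_inter_iff, and_assoc]

theorem cylinder_append_subset (T : Matrix (Fin n) (Fin n) ℝ) (σ τ : List (Fin n)) :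
    cylinder T (σ ++ τ) ⊆ cylinder T σ := by
  rw [cylinder_append]
  exact Set.inter_subset_left

theorem mem_cylinder_concat {T : Matrix (Fin n) (Fin n) ℝ} {σ : List (Fin n)} {a : Fin n}
    {x : ℤ → Fin n} : x ∈ cylinder T (σ ++ [a]) ↔ x ∈ cylinder T σ ∧ x σ.length = a := by
  rw [cylinder_append]
  simp [OccursAt]

theorem cylinder_eq_iUnion (T : Matrix (Fin n) (Fin n) ℝ) (σ : List (Fin n)) :
    cylinder T σ = ⋃ a, cylinder T (σ ++ [a]) := by
  ext x
  simp [mem_cylinder_concat]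

theorem pairwise_disjoint_cylinder_concat (T : Matrix (Fin n) (Fin n) ℝ) (σ : List (Fin n)) :
    Pairwise (Function.onFun Disjoint fun a => cylinder T (σ ++ [a])) := by
  intro a b hab
  refine Set.disjoint_left.mpr fun x hx hy => hab ?_
  rw [← (mem_cylinder_concat.mp hx).2, (mem_cylinder_concat.mp hy).2]

theorem admissible_of_mem_cylinder {T : Matrix (Fin n) (Fin n) ℝ} {σ : List (Fin n)}
    {x : ℤ → Fin n} (hx : x ∈ cylinder T σ) : Admissible T σ := by
  refine List.isChain_iff_getElem.mpr fun i hi => ?_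
  have h₁ := hx.2 i (by omega)
  have h₂ := hx.2 (i + 1) hi
  have h₃ := hx.1 i
  simp only [zero_add, List.get_eq_getElem, Nat.cast_add, Nat.cast_one] at h₁ h₂
  rwa [h₁, h₂] at h₃

theorem fword_nonneg (S : Finset (List (Fin n))) {t : ℝ} (ht : 0 ≤ t) (σ : List (Fin n))
    (x : ℤ → Fin n) : 0 ≤ fword S t σ x := by
  unfold fword
  refine Finset.sum_nonneg fun τ _ => Finset.sum_nonneg fun j _ => ?_
  split_ifs <;> positivity

theorem integrable_fword (μ : Measure (ℤ → Fin n)) [IsFiniteMeasure μ]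
    (S : Finset (List (Fin n))) (t : ℝ) (σ : List (Fin n)) : Integrable (fword S t σ) μ := by
  classical
  unfold fword
  refine integrable_finsetSum _ fun τ _ => integrable_finsetSum _ fun j _ => ?_
  have hm : MeasurableSet {x : ℤ → Fin n |
      τ.length ≤ σ.length + j ∧ OccursAt τ x ((σ.length : ℤ) + j - τ.length)} :=
    (MeasurableSet.const _).inter (measurableSet_occursAt _ _)
  refine ((integrable_const (t ^ j)).indicator hm).congr (Eventually.of_forall fun x => ?_)
  simp [Set.indicator_apply]

/-- Extending a word by one letter divides by `t` the contribution of the occurrences already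
begun, and adds the occurrences beginning at the new letter. -/
theorem fword_concat_le (S : Finset (List (Fin n))) {t : ℝ} (ht : 0 < t) (σ : List (Fin n))
    (a : Fin n) (x : ℤ → Fin n) :
    fword S t (σ ++ [a]) x ≤ (fword S t σ x +
      ∑ τ ∈ S, {y | OccursAt τ y σ.length}.indicator (fun _ => t ^ τ.length) x) / t := by
  classical
  rw [le_div_iff₀ ht]
  unfold fword
  rw [← Finset.sum_add_distrib, Finset.sum_mul]
  refine Finset.sum_le_sum fun τ _ => ?_
  set h : ℕ → ℝ := fun k =>
    if τ.length ≤ σ.length + k ∧ OccursAt τ x ((σ.length : ℤ) + k - τ.length)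
    then t ^ k else 0 with h_def
  have h_zero : 0 ≤ h 0 := by
    simp only [h_def]
    split_ifs <;> positivity
  have h_last : {y | OccursAt τ y σ.length}.indicator (fun _ => t ^ τ.length) x
      = h τ.length := by
    simp [h_def, Set.indicator_apply]
  have h_step : ∀ j : ℕ, (if τ.length ≤ (σ ++ [a]).length + j ∧
      OccursAt τ x (((σ ++ [a]).length : ℤ) + j - τ.length) then t ^ j else 0) * t
      = h (j + 1) := by
    intro j
    have h₁ : (σ ++ [a]).length + j = σ.length + (j + 1) := by simp; omega
    have h₂ : ((σ ++ [a]).length : ℤ) + j = σ.length + ((j + 1 : ℕ) : ℤ) := by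
      exact_mod_cast h₁
    simp only [h_def, h₁, h₂, ite_mul, zero_mul, pow_succ]
  rw [h_last, ← Finset.sum_range_succ, Finset.sum_mul, Finset.sum_congr rfl fun j _ => h_step j,
    Finset.sum_range_succ']
  linarith

theorem setIntegral_cylinder_eq_sum (T : Matrix (Fin n) (Fin n) ℝ) (μ : Measure (ℤ → Fin n))
    (σ : List (Fin n)) {g : (ℤ → Fin n) → ℝ} (hg : Integrable g μ) :
    ∫ x in cylinder T σ, g x ∂μ = ∑ a, ∫ x in cylinder T (σ ++ [a]), g x ∂μ := by
  rw [cylinder_eq_iUnion T σ]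
  exact integral_iUnion_fintype (fun a => measurableSet_cylinder T _)
    (pairwise_disjoint_cylinder_concat T σ) fun a => hg.integrableOn

theorem measureReal_cylinder_eq_sum (T : Matrix (Fin n) (Fin n) ℝ) (μ : Measure (ℤ → Fin n))
    [IsFiniteMeasure μ] (σ : List (Fin n)) :
    μ.real (cylinder T σ) = ∑ a, μ.real (cylinder T (σ ++ [a])) := by
  simpa using setIntegral_cylinder_eq_sum T μ σ (integrable_const (1 : ℝ))

theorem sum_setIntegral_fword_concat_le (T : Matrix (Fin n) (Fin n) ℝ)
    (μ : Measure (ℤ → Fin n)) [IsFiniteMeasure μ] (S : Finset (List (Fin n))) {t : ℝ}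
    (ht : 0 < t) (σ : List (Fin n)) :
    ∑ a, ∫ x in cylinder T (σ ++ [a]), fword S t (σ ++ [a]) x ∂μ ≤
      (∫ x in cylinder T σ, fword S t σ x ∂μ +
        ∑ τ ∈ S, μ.real (cylinder T (σ ++ τ)) * t ^ τ.length) / t := by
  have hi : ∀ τ ∈ S, Integrable
      ({y : ℤ → Fin n | OccursAt τ y σ.length}.indicator fun _ => t ^ τ.length) μ :=
    fun τ _ => (integrable_const _).indicator (measurableSet_occursAt _ _)
  have hs := integrable_finsetSum S hi
  have hg := ((integrable_fword μ S t σ).add hs).div_const t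
  calc _ ≤ ∑ a, ∫ x in cylinder T (σ ++ [a]), (fword S t σ x +
        ∑ τ ∈ S, {y | OccursAt τ y σ.length}.indicator (fun _ => t ^ τ.length) x) / t ∂μ :=
        Finset.sum_le_sum fun a _ => integral_mono (integrable_fword μ S t _).integrableOn
          hg.integrableOn fun x => fword_concat_le S ht σ a x
    _ = ∫ x in cylinder T σ, (fword S t σ x +
        ∑ τ ∈ S, {y | OccursAt τ y σ.length}.indicator (fun _ => t ^ τ.length) x) / t ∂μ :=
        (setIntegral_cylinder_eq_sum T μ σ hg).symm
    _ = _ := by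
        rw [integral_div, integral_add (integrable_fword μ S t σ).integrableOn hs.integrableOn,
          integral_finsetSum _ fun τ hτ => (hi τ hτ).integrableOn]
        congr 2
        refine Finset.sum_congr rfl fun τ _ => ?_
        rw [setIntegral_indicator (measurableSet_occursAt _ _), setIntegral_const,
          cylinder_append, smul_eq_mul]

open Classical in
/-- The one-letter extensions of `σ` of weight less than `1` fill a proportion at least `1 - r`
of the cylinder of `σ`. -/
theorem one_sub_mul_le_sum_good (T : Matrix (Fin n) (Fin n) ℝ) (μ : Measure (ℤ → Fin n))
    [IsFiniteMeasure μ] (S : Finset (List (Fin n))) {t r : ℝ} (ht : 0 < t)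
    {σ : List (Fin n)} (hσpos : 0 < μ.real (cylinder T σ)) (hσw : weight T μ S t σ < 1)
    (hr : (1 + pWord T μ S t σ) / t < r) :
    (1 - r) * μ.real (cylinder T σ) ≤
      ∑ a with Admissible T (σ ++ [a]) ∧ weight T μ S t (σ ++ [a]) < 1,
        μ.real (cylinder T (σ ++ [a])) := by
  have hF : ∀ a, 0 ≤ ∫ x in cylinder T (σ ++ [a]), fword S t (σ ++ [a]) x ∂μ := fun a =>
    integral_nonneg fun x => fword_nonneg S ht.le _ x
  have hbad : ∀ a, ¬ (Admissible T (σ ++ [a]) ∧ weight T μ S t (σ ++ [a]) < 1) →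
      μ.real (cylinder T (σ ++ [a])) ≤
        ∫ x in cylinder T (σ ++ [a]), fword S t (σ ++ [a]) x ∂μ := by
    intro a ha
    rcases (measureReal_nonneg (μ := μ) (s := cylinder T (σ ++ [a]))).eq_or_lt with h | h
    · rw [← h]
      exact hF a
    · obtain ⟨x, hx⟩ := nonempty_of_measureReal_ne_zero h.ne'
      have hw := not_lt.mp fun h' => ha ⟨admissible_of_mem_cylinder hx, h'⟩
      exact (one_le_div h).mp hw
  have hsplit := Finset.sum_filter_add_sum_filter_not Finset.univ
    (fun a => Admissible T (σ ++ [a]) ∧ weight T μ S t (σ ++ [a]) < 1)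
    fun a => μ.real (cylinder T (σ ++ [a]))
  rw [← measureReal_cylinder_eq_sum] at hsplit
  have hbad_sum : ∑ a with ¬ (Admissible T (σ ++ [a]) ∧ weight T μ S t (σ ++ [a]) < 1),
      μ.real (cylinder T (σ ++ [a])) ≤
        ∑ a, ∫ x in cylinder T (σ ++ [a]), fword S t (σ ++ [a]) x ∂μ :=
    (Finset.sum_le_sum fun a ha => hbad a (Finset.mem_filter.mp ha).2).trans
      (Finset.sum_le_sum_of_subset_of_nonneg (Finset.filter_subset _ _) fun a _ _ => hF a)
  have hp : ∑ τ ∈ S, μ.real (cylinder T (σ ++ τ)) * t ^ τ.length =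
      pWord T μ S t σ * μ.real (cylinder T σ) := by
    unfold pWord
    rw [Finset.sum_mul]
    refine Finset.sum_congr rfl fun τ _ => ?_
    simp only [← measureReal_def]
    field_simp
  have hw : ∫ x in cylinder T σ, fword S t σ x ∂μ ≤ μ.real (cylinder T σ) :=
    ((div_lt_one hσpos).mp hσw).le
  have key : ∑ a, ∫ x in cylinder T (σ ++ [a]), fword S t (σ ++ [a]) x ∂μ ≤
      r * μ.real (cylinder T σ) := calc
    _ ≤ _ := sum_setIntegral_fword_concat_le T μ S ht σ
    _ ≤ (μ.real (cylinder T σ) + pWord T μ S t σ * μ.real (cylinder T σ)) / t := by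
      rw [hp]
      gcongr
    _ = (1 + pWord T μ S t σ) / t * μ.real (cylinder T σ) := by ring
    _ ≤ _ := by gcongr
  linarith

theorem GSet_subset_cylinder (T : Matrix (Fin n) (Fin n) ℝ) (μ : Measure (ℤ → Fin n))
    (S : Finset (List (Fin n))) (t : ℝ) (σ : List (Fin n)) (m : ℕ) :
    GSet T μ S t σ m ⊆ cylinder T σ :=
  Set.iUnion₂_subset fun _ _ => cylinder_append_subset T _ _

theorem GSet_concat_subset {T : Matrix (Fin n) (Fin n) ℝ} {μ : Measure (ℤ → Fin n)}
    {S : Finset (List (Fin n))} {t : ℝ} {σ : List (Fin n)} (hσw : weight T μ S t σ < 1)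
    (a : Fin n) (m : ℕ) : GSet T μ S t (σ ++ [a]) m ⊆ GSet T μ S t σ (m + 1) := by
  refine Set.iUnion₂_subset fun η hη => ?_
  obtain ⟨hlen, hadm, hpre⟩ := hη
  have hassoc : ∀ l : List (Fin n), σ ++ [a] ++ l = σ ++ a :: l := fun l => by simp
  simp only [hassoc] at hadm hpre ⊢
  refine Set.subset_biUnion_of_mem (u := fun η => cylinder T (σ ++ η))
    (show a :: η ∈ _ from ⟨by simp [hlen], hadm, fun η' hη' => ?_⟩)
  rcases List.prefix_cons_iff.mp hη' with rfl | ⟨l, rfl, hl⟩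
  · simpa using hσw
  · exact hpre l hl

theorem GSet_zero {T : Matrix (Fin n) (Fin n) ℝ} {μ : Measure (ℤ → Fin n)}
    {S : Finset (List (Fin n))} {t : ℝ} {σ : List (Fin n)} (hσ : Admissible T σ)
    (hσw : weight T μ S t σ < 1) : GSet T μ S t σ 0 = cylinder T σ := by
  refine (GSet_subset_cylinder T μ S t σ 0).antisymm fun x hx => ?_
  refine Set.mem_biUnion (show [] ∈ _ from ⟨rfl, by simpa using hσ, fun η' hη' => ?_⟩)
    (by simpa using hx)
  simpa [List.prefix_nil.mp hη'] using hσw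

theorem one_sub_pow_mul_le_measureReal_GSet (T : Matrix (Fin n) (Fin n) ℝ)
    (μ : Measure (ℤ → Fin n)) [IsFiniteMeasure μ] (S : Finset (List (Fin n))) {t r : ℝ}
    (ht : 0 < t) (hr1 : r < 1)
    (hpos : ∀ ρ, Admissible T ρ → 0 < μ.real (cylinder T ρ))
    (hr : ∀ ρ, Admissible T ρ → (1 + pWord T μ S t ρ) / t < r) (m : ℕ) :
    ∀ σ, Admissible T σ → weight T μ S t σ < 1 →
      (1 - r) ^ m * μ.real (cylinder T σ) ≤ μ.real (GSet T μ S t σ m) := by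
  classical
  induction m with
  | zero =>
    intro σ hσ hσw
    simp [GSet_zero hσ hσw]
  | succ m ih =>
    intro σ hσ hσw
    have hr0 : 0 ≤ (1 - r) ^ m := pow_nonneg (by linarith) m
    calc (1 - r) ^ (m + 1) * μ.real (cylinder T σ)
        = (1 - r) ^ m * ((1 - r) * μ.real (cylinder T σ)) := by ring
      _ ≤ (1 - r) ^ m *
          ∑ a with Admissible T (σ ++ [a]) ∧ weight T μ S t (σ ++ [a]) < 1,
            μ.real (cylinder T (σ ++ [a])) :=
          mul_le_mul_of_nonneg_left
            (one_sub_mul_le_sum_good T μ S ht (hpos σ hσ) hσw (hr σ hσ)) hr0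
      _ ≤ ∑ a with Admissible T (σ ++ [a]) ∧ weight T μ S t (σ ++ [a]) < 1,
            μ.real (GSet T μ S t (σ ++ [a]) m) := by
          rw [Finset.mul_sum]
          refine Finset.sum_le_sum fun a ha => ?_
          obtain ⟨hadm, hw⟩ := (Finset.mem_filter.mp ha).2
          exact ih _ hadm hw
      _ = μ.real (⋃ a ∈ ({a | Admissible T (σ ++ [a]) ∧ weight T μ S t (σ ++ [a]) < 1} :
            Finset (Fin n)), GSet T μ S t (σ ++ [a]) m) := by
          refine (measureReal_biUnion_finset (fun a _ b _ hab => ?_)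
            fun a _ => measurableSet_GSet T μ S t _ m).symm
          exact (pairwise_disjoint_cylinder_concat T σ hab).mono
            (GSet_subset_cylinder _ _ _ _ _ _) (GSet_subset_cylinder _ _ _ _ _ _)
      _ ≤ μ.real (GSet T μ S t σ (m + 1)) :=
          measureReal_mono (Set.iUnion₂_subset fun a _ => GSet_concat_subset hσw a m)

end

/-- **Lemma 3 (main estimate).** Fix `t > 1` and suppose `(1 + p_ρ)/t < r < 1` for
all admissible words `ρ`. If `σ` is `S`-free and admissible with `w(σ) < 1`, then
`μ(G(σ,m))/μ([σ]) ≥ (1 - r)^m` for all `m ≥ 1`. -/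
theorem main_estimate
    {n : ℕ} [NeZero n] (T : Matrix (Fin n) (Fin n) ℝ) (lam : ℝ) (u v : Fin n → ℝ)
    (μ : Measure (ℤ → Fin n))
    (hT01 : ∀ i j, T i j = 0 ∨ T i j = 1)
    (hirr : ∀ i j : Fin n, ∃ m : ℕ, 0 < m ∧ 0 < (T ^ m) i j)
    (hlam : 1 < lam)
    (hu : ∀ i, 0 < u i) (hv : ∀ i, 0 < v i)
    (huT : Matrix.vecMul u T = lam • u)
    (hTv : T.mulVec v = lam • v)
    (huv : ∑ i, u i * v i = 1)
    (hprob : IsProbabilityMeasure μ)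
    (hinv : MeasurePreserving (fun (x : ℤ → Fin n) (i : ℤ) => x (i + 1)) μ μ)
    (hcyl : ∀ σ : List (Fin n), σ ≠ [] → Admissible T σ →
      μ (cylinder T σ) = ENNReal.ofReal (u σ.head! * v σ.getLast! / lam ^ (σ.length - 1)))
    (S : Finset (List (Fin n)))
    (hSne : ∀ τ ∈ S, τ ≠ [])
    (hSadm : ∀ τ ∈ S, Admissible T τ)
    (hSanti : ∀ τ ∈ S, ∀ τ' ∈ S, τ ≠ τ' → ¬ τ <:+: τ')
    (t : ℝ) (ht : 1 < t) (r : ℝ) (hr1 : r < 1)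
    (hr : ∀ ρ : List (Fin n), Admissible T ρ → (1 + pWord T μ S t ρ) / t < r)
    (σ : List (Fin n)) (hσ : Admissible T σ) (hσfree : SFree S σ)
    (hσw : weight T μ S t σ < 1) :
    ∀ m : ℕ, 1 ≤ m →
      (1 - r) ^ m ≤ (μ (GSet T μ S t σ m)).toReal / (μ (cylinder T σ)).toReal := by
  have hpos_ne : ∀ ρ, ρ ≠ [] → Admissible T ρ → 0 < μ.real (cylinder T ρ) := by
    intro ρ hne hρ
    have := hu ρ.head!
    have := hv ρ.getLast!
    rw [measureReal_def, hcyl ρ hne hρ, ENNReal.toReal_ofReal (by positivity)]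
    positivity
  have hpos : ∀ ρ, Admissible T ρ → 0 < μ.real (cylinder T ρ) := by
    intro ρ hρ
    rcases eq_or_ne ρ [] with rfl | hne
    · exact (hpos_ne [0] (by simp) (List.isChain_singleton _)).trans_le
        (measureReal_mono (cylinder_append_subset T [] [0]))
    · exact hpos_ne ρ hne hρ
  intro m _
  rw [← measureReal_def, ← measureReal_def, le_div_iff₀ (hpos σ hσ)]
  exact one_sub_pow_mul_le_measureReal_GSet T μ S (by linarith) hr1 hpos hr m σ hσ hσw

end SFT
end

section
/- Suppose there exists t > 1 with r = (1 + D·A^{−1}·p(t/λ))/t < 1. Then for every integer m ≥ 1 there are at least A·D^{−1}·λ^m·(1 − r)^m admissible words of length m that are S-free. -/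
open Filter MeasureTheory
open scoped BigOperators

namespace SFT

theorem sum_biUnion_le {ι κ : Type*} [DecidableEq ι] [DecidableEq κ] (s : Finset ι)
    (f : ι → Finset κ) {g : κ → ℝ} (hg : ∀ x, 0 ≤ g x) :
    ∑ x ∈ s.biUnion f, g x ≤ ∑ i ∈ s, ∑ x ∈ f i, g x := by
  induction s using Finset.induction_on with
  | empty => simp
  | insert i s hi ih =>
    rw [Finset.biUnion_insert, Finset.sum_insert hi]
    refine ((le_add_of_nonneg_right (Finset.sum_nonneg fun x _ => hg x)).trans_eq
      Finset.sum_union_inter).trans ?_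
    gcongr

/-- A nonnegative sequence whose increments satisfy a Golod–Shafarevich type recursive
bound grows at least geometrically. -/
theorem geometric_growth {ι : Type*} (S : Finset ι) (l : ι → ℕ) (hl : ∀ τ ∈ S, 0 < l τ)
    (b : ℕ → ℝ) (hb : ∀ m, 0 ≤ b m) {D lam t : ℝ} (hD : 0 < D) (hlam : 0 < lam) (ht : 0 < t)
    (hrec : ∀ m, b m ≤ b (m + 1) +
      ∑ τ ∈ S with l τ ≤ m + 1, D / lam ^ l τ * b (m + 1 - l τ))
    (hr : (1 + D * ∑ τ ∈ S, (t / lam) ^ l τ) / t ≤ 1) (m : ℕ) :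
    (1 - D * (∑ τ ∈ S, (t / lam) ^ l τ) / t) * b m ≤ b (m + 1) := by
  induction m using Nat.strong_induction_on with
  | _ m ih =>
  have hstep : ∀ k < m, b k ≤ t * b (k + 1) := fun k hk => by
    have h := ih k hk
    have hinv : 1 / t ≤ 1 - D * (∑ τ ∈ S, (t / lam) ^ l τ) / t := by
      rw [add_div] at hr
      linarith
    have h' : 1 / t * b k ≤ b (k + 1) := (mul_le_mul_of_nonneg_right hinv (hb k)).trans h
    rw [one_div, inv_mul_le_iff₀ ht] at h'
    exact h'
  have hback : ∀ j ≤ m, b (m - j) ≤ t ^ j * b m := by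
    intro j
    induction j with
    | zero => simp
    | succ j ihj =>
      intro hj
      have h := hstep (m - (j + 1)) (by omega)
      rw [show m - (j + 1) + 1 = m - j by omega] at h
      calc b (m - (j + 1)) ≤ t * b (m - j) := h
        _ ≤ t * (t ^ j * b m) := by gcongr; exact ihj (by omega)
        _ = t ^ (j + 1) * b m := by ring
  have hsum : ∑ τ ∈ S with l τ ≤ m + 1, D / lam ^ l τ * b (m + 1 - l τ) ≤
      D * (∑ τ ∈ S, (t / lam) ^ l τ) / t * b m := by
    calc ∑ τ ∈ S with l τ ≤ m + 1, D / lam ^ l τ * b (m + 1 - l τ)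
        ≤ ∑ τ ∈ S with l τ ≤ m + 1, D * (t / lam) ^ l τ / t * b m := by
          refine Finset.sum_le_sum fun τ hτ => ?_
          obtain ⟨hτS, hτm⟩ := Finset.mem_filter.1 hτ
          obtain ⟨j, hj⟩ : ∃ j, l τ = j + 1 := Nat.exists_eq_add_one.2 (hl τ hτS)
          have h := hback j (by omega)
          rw [hj, Nat.add_sub_add_right]
          calc D / lam ^ (j + 1) * b (m - j) ≤ D / lam ^ (j + 1) * (t ^ j * b m) := by gcongr
            _ = D * (t / lam) ^ (j + 1) / t * b m := by
              rw [div_pow, pow_succ t]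
              field_simp
      _ ≤ ∑ τ ∈ S, D * (t / lam) ^ l τ / t * b m :=
          Finset.sum_le_sum_of_subset_of_nonneg (Finset.filter_subset _ _) fun τ _ _ => by
            have := hb m
            positivity
      _ = D * (∑ τ ∈ S, (t / lam) ^ l τ) / t * b m := by
          rw [Finset.mul_sum, Finset.sum_div, Finset.sum_mul]
  have := hrec m
  linarith

theorem admissible_iff_isChain {n : ℕ} {T : Matrix (Fin n) (Fin n) ℝ} {w : List (Fin n)} :
    Admissible T w ↔ w.IsChain fun a b => T b a = 1 :=
  Iff.rfl

/-- The mass of a word, up to normalization the Parry measure of its cylinder as a function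
of the first letter only; it is additive under prepending a letter. -/
noncomputable def wordMass {n : ℕ} (v : Fin n → ℝ) (lam : ℝ) : List (Fin n) → ℝ
  | [] => (∑ i, v i) / lam
  | a :: w => v a / lam ^ (w.length + 1)

theorem wordMass_nonneg {n : ℕ} {v : Fin n → ℝ} {lam : ℝ} (hv : ∀ i, 0 < v i) (hlam : 0 < lam)
    (w : List (Fin n)) : 0 ≤ wordMass v lam w := by
  cases w with
  | nil => exact div_nonneg (Finset.sum_nonneg fun i _ => (hv i).le) hlam.le
  | cons a w => exact div_nonneg (hv a).le (by positivity)

theorem eigenvalue_mul_le_sum {n : ℕ} {T : Matrix (Fin n) (Fin n) ℝ} {lam : ℝ} {v : Fin n → ℝ}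
    (hT01 : ∀ i j, T i j = 0 ∨ T i j = 1) (hv : ∀ i, 0 < v i) (hTv : T.mulVec v = lam • v)
    (i : Fin n) : lam * v i ≤ ∑ j, v j := by
  have h := congrFun hTv i
  simp only [Matrix.mulVec, dotProduct, Pi.smul_apply, smul_eq_mul] at h
  rw [← h]
  refine Finset.sum_le_sum fun j _ => ?_
  rcases hT01 i j with h | h <;> simp [h, (hv j).le]

/-- Prepending a word `τ` multiplies the mass by at most `D / lam ^ |τ|`. -/
theorem wordMass_append_le {n : ℕ} {T : Matrix (Fin n) (Fin n) ℝ} {lam : ℝ} {v : Fin n → ℝ}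
    {D : ℝ} (hT01 : ∀ i j, T i j = 0 ∨ T i j = 1) (hlam : 0 < lam) (hv : ∀ i, 0 < v i)
    (hTv : T.mulVec v = lam • v) (hD : ∀ i j, v i / v j ≤ D) {τ : List (Fin n)} (hτ : τ ≠ [])
    (w : List (Fin n)) :
    wordMass v lam (τ ++ w) ≤ D / lam ^ τ.length * wordMass v lam w := by
  obtain ⟨a, τ, rfl⟩ := List.exists_cons_of_ne_nil hτ
  have hD' : ∀ b, v a ≤ D * v b := fun b => (div_le_iff₀ (hv b)).1 (hD a b)
  have hDpos : 0 < D := (div_pos (hv a) (hv a)).trans_le (hD a a)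
  cases w with
  | nil =>
    simp only [List.append_nil, wordMass, List.length_cons]
    rw [div_mul_eq_mul_div]
    gcongr
    refine (hD' a).trans ?_
    gcongr
    rw [le_div_iff₀ hlam, mul_comm]
    exact eigenvalue_mul_le_sum hT01 hv hTv a
  | cons c w =>
    simp only [List.cons_append, wordMass, List.length_append, List.length_cons]
    rw [div_mul_div_comm, ← pow_add, show τ.length + (w.length + 1) + 1 =
      τ.length + 1 + (w.length + 1) by omega]
    gcongr
    exact hD' c

open Classical in
/-- The mass of an admissible word is the total mass of its admissible one-letter extensions
to the left. -/
theorem sum_wordMass_cons {n : ℕ} {T : Matrix (Fin n) (Fin n) ℝ} {lam : ℝ} {v : Fin n → ℝ}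
    (hT01 : ∀ i j, T i j = 0 ∨ T i j = 1) (hlam : 0 < lam) (hTv : T.mulVec v = lam • v)
    {w : List (Fin n)} (hw : Admissible T w) :
    ∑ a with Admissible T (a :: w), wordMass v lam (a :: w) = wordMass v lam w := by
  cases w with
  | nil => simp [admissible_iff_isChain, wordMass, Finset.sum_div]
  | cons c w =>
    have h := congrFun hTv c
    simp only [Matrix.mulVec, dotProduct, Pi.smul_apply, smul_eq_mul] at h
    have hadm : ∀ a, Admissible T (a :: c :: w) ↔ T c a = 1 := fun a => by
      rw [admissible_iff_isChain] at hw ⊢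
      simp [List.isChain_cons_cons, hw]
    simp only [hadm, wordMass, List.length_cons]
    rw [← Finset.sum_div, pow_succ, mul_comm, ← div_div,
      ← mul_div_cancel_left₀ (v c) hlam.ne', ← h, Finset.sum_filter]
    congr 2
    refine Finset.sum_congr rfl fun a _ => ?_
    rcases hT01 c a with h | h <;> simp [h]

/-- The `S`-free admissible words of length `m`. -/
noncomputable def freeWords {n : ℕ} (T : Matrix (Fin n) (Fin n) ℝ) (S : Finset (List (Fin n)))
    (m : ℕ) : Finset (List (Fin n)) :=
  ((List.finite_length_eq (Fin n) m).subset fun _ h => h.1 :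
    {w | w.length = m ∧ Admissible T w ∧ SFree S w}.Finite).toFinset

theorem mem_freeWords {n : ℕ} {T : Matrix (Fin n) (Fin n) ℝ} {S : Finset (List (Fin n))}
    {m : ℕ} {w : List (Fin n)} :
    w ∈ freeWords T S m ↔ w.length = m ∧ Admissible T w ∧ SFree S w := by
  simp [freeWords]

/-- Prepending a letter to an `S`-free word yields an `S`-free word or a word of the form
`τ ++ w'` with `τ ∈ S` and `w'` an `S`-free word. -/
theorem cons_mem_freeWords_or {n : ℕ} {T : Matrix (Fin n) (Fin n) ℝ}
    {S : Finset (List (Fin n))} (hSne : ∀ τ ∈ S, τ ≠ []) {m : ℕ} {a : Fin n}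
    {w : List (Fin n)} (hw : w ∈ freeWords T S m) (haw : Admissible T (a :: w)) :
    a :: w ∈ freeWords T S (m + 1) ∨ ∃ τ ∈ S, τ.length ≤ m + 1 ∧
      ∃ w' ∈ freeWords T S (m + 1 - τ.length), τ ++ w' = a :: w := by
  obtain ⟨hlen, hadm, hfree⟩ := mem_freeWords.1 hw
  by_cases h : SFree S (a :: w)
  · exact Or.inl (mem_freeWords.2 ⟨by simp [hlen], haw, h⟩)
  · right
    simp only [SFree, not_forall, not_not] at h
    obtain ⟨τ, hτ, hinf⟩ := h
    rcases List.infix_cons_iff.1 hinf with ⟨w', hw'⟩ | hinf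
    · have hl : τ.length + w'.length = m + 1 := by
        rw [← List.length_append, hw', List.length_cons, hlen]
      obtain ⟨c, τ', rfl⟩ := List.exists_cons_of_ne_nil (hSne τ hτ)
      have hsuf : w' <:+ w := ⟨τ', by simpa using (List.cons.inj hw').2⟩
      refine ⟨_, hτ, by omega, w', mem_freeWords.2 ⟨by omega, ?_, ?_⟩, hw'⟩
      · exact List.IsChain.suffix hadm hsuf
      · exact fun ρ hρ hinf => hfree ρ hρ (hinf.trans hsuf.isInfix)
    · exact absurd hinf (hfree τ hτ)

theorem sum_wordMass_freeWords_le {n : ℕ} {T : Matrix (Fin n) (Fin n) ℝ} {lam : ℝ}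
    {v : Fin n → ℝ} {D : ℝ} (hT01 : ∀ i j, T i j = 0 ∨ T i j = 1) (hlam : 0 < lam)
    (hv : ∀ i, 0 < v i) (hTv : T.mulVec v = lam • v) (hD : ∀ i j, v i / v j ≤ D)
    {S : Finset (List (Fin n))} (hSne : ∀ τ ∈ S, τ ≠ []) (m : ℕ) :
    ∑ w ∈ freeWords T S m, wordMass v lam w ≤
      ∑ w ∈ freeWords T S (m + 1), wordMass v lam w +
      ∑ τ ∈ S with τ.length ≤ m + 1, D / lam ^ τ.length *
        ∑ w ∈ freeWords T S (m + 1 - τ.length), wordMass v lam w := by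
  classical
  set E := ((freeWords T S m).sigma fun w =>
    Finset.univ.filter fun a => Admissible T (a :: w)).image fun p => p.2 :: p.1 with hE
  have hnn := wordMass_nonneg hv hlam
  have hsumE : ∑ w ∈ freeWords T S m, wordMass v lam w = ∑ x ∈ E, wordMass v lam x := by
    rw [hE, Finset.sum_image, Finset.sum_sigma]
    · exact Finset.sum_congr rfl fun w hw =>
        (sum_wordMass_cons hT01 hlam hTv (mem_freeWords.1 hw).2.1).symm
    · rintro ⟨w, a⟩ - ⟨w', a'⟩ - h
      obtain ⟨rfl, rfl⟩ := List.cons.inj h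
      rfl
  have hsub : E ⊆ freeWords T S (m + 1) ∪ (S.filter fun τ => τ.length ≤ m + 1).biUnion
      fun τ => (freeWords T S (m + 1 - τ.length)).image (τ ++ ·) := by
    intro x hx
    obtain ⟨⟨w, a⟩, hp, rfl⟩ := Finset.mem_image.1 hx
    obtain ⟨hw, ha⟩ := Finset.mem_sigma.1 hp
    rcases cons_mem_freeWords_or hSne hw (Finset.mem_filter.1 ha).2 with h | ⟨τ, hτ, hl, w', hw', h⟩
    · exact Finset.mem_union_left _ h
    · exact Finset.mem_union_right _ (Finset.mem_biUnion.2
        ⟨τ, Finset.mem_filter.2 ⟨hτ, hl⟩, Finset.mem_image.2 ⟨w', hw', h⟩⟩)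
  rw [hsumE]
  calc ∑ x ∈ E, wordMass v lam x
      ≤ _ := Finset.sum_le_sum_of_subset_of_nonneg hsub fun _ _ _ => hnn _
    _ ≤ _ := (le_add_of_nonneg_right (Finset.sum_nonneg fun _ _ => hnn _)).trans_eq
        (Finset.sum_union_inter)
    _ ≤ _ := by
      gcongr
      refine (sum_biUnion_le _ _ hnn).trans ?_
      refine Finset.sum_le_sum fun τ hτ => ?_
      rw [Finset.sum_image fun _ _ _ _ h => List.append_cancel_left h, Finset.mul_sum]
      exact Finset.sum_le_sum fun w _ =>
        wordMass_append_le hT01 hlam hv hTv hD (hSne τ (Finset.mem_filter.1 hτ).1) w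

/-- The constant in a lower bound `A * lam ^ k` on the number of extensions is at most `1`. -/
theorem le_one_of_le_extCount {n : ℕ} [Nonempty (Fin n)] {T : Matrix (Fin n) (Fin n) ℝ}
    {lam : ℝ} {u : Fin n → ℝ} {A : ℝ} (hT01 : ∀ i j, T i j = 0 ∨ T i j = 1) (hlam : 0 < lam)
    (hu : ∀ i, 0 < u i) (huT : Matrix.vecMul u T = lam • u)
    (hA : ∀ a, A * lam ≤ extCount T [a] 1) : A ≤ 1 := by
  classical
  obtain ⟨s, hs⟩ := Finite.exists_min u
  have hcount : extCount T [s] 1 = (Finset.univ.filter fun i => T i s = 1).card := by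
    rw [extCount, ← Set.ncard_coe_finset,
      ← Set.ncard_image_of_injective (↑(Finset.univ.filter fun i => T i s = 1) : Set (Fin n))
        List.singleton_injective]
    refine congrArg Set.ncard (Set.ext fun w => ?_)
    simp only [Set.mem_ofPred_eq, List.length_eq_one_iff, Set.mem_image, Finset.coe_filter,
      Finset.mem_univ, true_and]
    constructor
    · rintro ⟨⟨i, rfl⟩, h⟩
      exact ⟨i, by simpa [admissible_iff_isChain] using h, rfl⟩
    · rintro ⟨i, h, rfl⟩
      exact ⟨⟨i, rfl⟩, by simpa [admissible_iff_isChain] using h⟩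
  have h := congrFun huT s
  simp only [Matrix.vecMul, dotProduct, Pi.smul_apply, smul_eq_mul] at h
  have hle : (extCount T [s] 1 : ℝ) * u s ≤ lam * u s := by
    rw [← h, hcount, ← nsmul_eq_mul, ← Finset.sum_const, Finset.sum_filter]
    refine Finset.sum_le_sum fun i _ => ?_
    rcases hT01 i s with h | h <;> simp [h, hs i]
  have := (hA s).trans (le_of_mul_le_mul_right hle (hu s))
  exact le_of_mul_le_mul_right (by linarith) hlam

/-- If there is `t > 1` with `r = (1 + D·A⁻¹·p(t/λ))/t < 1`, then for every `m ≥ 1`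
there are at least `A·D⁻¹·λ^m·(1 - r)^m` admissible `S`-free words of length `m`. -/
theorem count_SFree_words
    {n : ℕ} (T : Matrix (Fin n) (Fin n) ℝ) (lam : ℝ) (u v : Fin n → ℝ) (A D : ℝ)
    (hT01 : ∀ i j, T i j = 0 ∨ T i j = 1)
    (hirr : ∀ i j : Fin n, ∃ m : ℕ, 0 < m ∧ 0 < (T ^ m) i j)
    (hlam : 1 < lam)
    (hu : ∀ i, 0 < u i) (hv : ∀ i, 0 < v i)
    (huT : Matrix.vecMul u T = lam • u)
    (hTv : T.mulVec v = lam • v)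
    (huv : ∑ i, u i * v i = 1)
    (hA : 0 < A)
    (hAbound : ∀ σ : List (Fin n), Admissible T σ → ∀ k : ℕ, 1 ≤ k →
      A * lam ^ k ≤ (extCount T σ k : ℝ))
    (hD : ∀ i j : Fin n, v i / v j ≤ D)
    (S : Finset (List (Fin n)))
    (hSne : ∀ τ ∈ S, τ ≠ [])
    (hSadm : ∀ τ ∈ S, Admissible T τ)
    (hSanti : ∀ τ ∈ S, ∀ τ' ∈ S, τ ≠ τ' → ¬ τ <:+: τ')
    (t : ℝ) (ht : 1 < t)
    (hr : (1 + D * A⁻¹ * wordPoly S (t / lam)) / t < 1) :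
    ∀ m : ℕ, 1 ≤ m →
      A * D⁻¹ * lam ^ m * (1 - (1 + D * A⁻¹ * wordPoly S (t / lam)) / t) ^ m ≤
        ({w : List (Fin n) | w.length = m ∧ Admissible T w ∧ SFree S w}.ncard : ℝ) := by
  intro m hm
  have hlam0 : 0 < lam := by linarith
  have ht0 : 0 < t := by linarith
  have hne : Nonempty (Fin n) := by
    by_contra h
    rw [not_nonempty_iff] at h
    simp at huv
  obtain ⟨i, hi⟩ := Finite.exists_max v
  obtain ⟨j, hj⟩ := Finite.exists_min v
  have hDpos : 0 < D := (div_pos (hv i) (hv i)).trans_le (hD i i)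
  have hA1 : A ≤ 1 := le_one_of_le_extCount hT01 hlam0 hu huT fun a => by
    simpa using hAbound [a] (by simp [admissible_iff_isChain]) 1 le_rfl
  have hP : 0 ≤ wordPoly S (t / lam) := Finset.sum_nonneg fun _ _ => by positivity
  set P := wordPoly S (t / lam) with hPdef
  set r := (1 + D * A⁻¹ * P) / t with hrdef
  set b : ℕ → ℝ := fun k => ∑ w ∈ freeWords T S k, wordMass v lam w with hb
  have hDA : D * P ≤ D * A⁻¹ * P := by
    gcongr
    exact le_mul_of_one_le_right hDpos.le ((one_le_inv₀ hA).2 hA1)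
  have hb0 : ∀ k, 0 ≤ b k := fun k =>
    Finset.sum_nonneg fun w _ => wordMass_nonneg hv hlam0 w
  have hr' : (1 + D * P) / t ≤ r := by rw [hrdef]; gcongr
  have hgrow : ∀ k, (1 - r) * b k ≤ b (k + 1) := fun k => by
    refine le_trans ?_ (geometric_growth S List.length
      (fun τ hτ => List.length_pos_iff.2 (hSne τ hτ)) b hb0 hDpos hlam0 ht0
      (sum_wordMass_freeWords_le hT01 hlam0 hv hTv hD hSne) (hr'.trans hr.le) k)
    refine mul_le_mul_of_nonneg_right ?_ (hb0 k)
    have : D * P / t ≤ (1 + D * P) / t := by gcongr; linarith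
    change 1 - r ≤ 1 - D * P / t
    linarith
  have hr0 : 0 ≤ 1 - r := by linarith
  have hpow : ∀ k, (1 - r) ^ k * b 0 ≤ b k := fun k => by
    induction k with
    | zero => simp
    | succ k ih =>
      calc (1 - r) ^ (k + 1) * b 0 = (1 - r) * ((1 - r) ^ k * b 0) := by ring
        _ ≤ (1 - r) * b k := by gcongr
        _ ≤ b (k + 1) := hgrow k
  have hb00 : v j ≤ b 0 := by
    have hfree : freeWords T S 0 = {[]} := by
      ext w
      simp only [mem_freeWords, List.length_eq_zero_iff, Finset.mem_singleton]
      refine ⟨fun h => h.1, ?_⟩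
      rintro rfl
      exact ⟨rfl, by simp [admissible_iff_isChain], fun τ hτ h => hSne τ hτ (List.infix_nil.1 h)⟩
    simp only [hb, hfree, Finset.sum_singleton, wordMass]
    rw [le_div_iff₀ hlam0, mul_comm]
    exact eigenvalue_mul_le_sum hT01 hv hTv j
  have hbm : b m ≤ (freeWords T S m).card * (v i / lam ^ m) := by
    rw [← nsmul_eq_mul]
    refine Finset.sum_le_card_nsmul _ _ _ fun w hw => ?_
    have hw := (mem_freeWords.1 hw).1
    cases w with
    | nil => simp at hw; omega
    | cons a w =>
      rw [List.length_cons] at hw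
      rw [wordMass, hw]
      gcongr
      exact hi a
  have hcard : {w : List (Fin n) | w.length = m ∧ Admissible T w ∧ SFree S w}.ncard =
      (freeWords T S m).card :=
    Set.ncard_eq_toFinset_card _ ((List.finite_length_eq (Fin n) m).subset fun _ h => h.1)
  rw [hcard]
  have hvD : v i ≤ D * v j := (div_le_iff₀ (hv j)).1 (hD i j)
  have key : (1 - r) ^ m * v j ≤ (freeWords T S m).card * (v i / lam ^ m) :=
    ((mul_le_mul_of_nonneg_left hb00 (pow_nonneg hr0 m)).trans (hpow m)).trans hbm
  have key' : lam ^ m * (1 - r) ^ m * v j ≤ (freeWords T S m).card * D * v j := by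
    rw [← mul_div_assoc, le_div_iff₀ (by positivity)] at key
    calc lam ^ m * (1 - r) ^ m * v j = (1 - r) ^ m * v j * lam ^ m := by ring
      _ ≤ (freeWords T S m).card * v i := key
      _ ≤ (freeWords T S m).card * (D * v j) := by gcongr
      _ = _ := by ring
  calc A * D⁻¹ * lam ^ m * (1 - r) ^ m = A * (lam ^ m * (1 - r) ^ m / D) := by
        rw [div_eq_mul_inv]
        ring
    _ ≤ 1 * (lam ^ m * (1 - r) ^ m / D) := by gcongr
    _ ≤ (freeWords T S m).card := by
      rw [one_mul, div_le_iff₀ hDpos]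
      exact le_of_mul_le_mul_right key' (hv j)

end SFT
end
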